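/- Let n ≥ 2 and let f be a fixed-point-free involution of ZMod (2n) (a chord diagram with n chords). Suppose p, p+1, q, q+1 are four distinct points with f p = q and f (p+1) = q + 1, so that c₁ = {p, q} and c₂ = {p+1, q+1} are two chords of f in the parallel configuration of a second Reidemeister move. Then every chord of f other than c₁ and c₂ is linked with c₁ if and only if it is linked with c₂; consequently c₁ and c₂ have the same Gaussian parity. (This is the paper's parity axiom 2 for the Gaussian parity, for the other chord-diagram version of the second Reidemeister move.) -/

import Mathlib

/-- `x` lies strictly between `a` and `b` in the cyclic order on `ZMod m`:
writing `b = a + j` with `j = (b - a).val`, `x = a + k` for some `1 ≤ k ≤ j - 1`. -/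
def inOpenArc {m : ℕ} (a b x : ZMod m) : Prop :=
  ∃ k : ℕ, 1 ≤ k ∧ k < (b - a).val ∧ x = a + (k : ZMod m)

/-- The pairs `{a, b}` and `{c, d}` are linked: exactly one of `c`, `d`
lies in the open arc from `a` to `b`. -/
def linked {m : ℕ} (a b c d : ZMod m) : Prop :=
  Xor' (inOpenArc a b c) (inOpenArc a b d)

/-- Linking of unordered pairs (given as two-element finsets). -/
def linkedPair {m : ℕ} (P Q : Finset (ZMod m)) : Prop :=
  ∃ a b c d : ZMod m, P = {a, b} ∧ Q = {c, d} ∧ linked a b c d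

/-- The chords of a chord diagram given by an involution `f` of `ZMod (2*n)`. -/
def chords {n : ℕ} (f : ZMod (2 * n) → ZMod (2 * n)) : Set (Finset (ZMod (2 * n))) :=
  {P | ∃ a, P = {a, f a}}

theorem arc_iff {m : ℕ} [NeZero m] (a b x : ZMod m) :
    inOpenArc a b x ↔ 0 < (x - a).val ∧ (x - a).val < (b - a).val := by
  constructor
  · rintro ⟨k, h1, h2, rfl⟩
    have hk : k < m := h2.trans (ZMod.val_lt _)
    have : (a + (k : ZMod m) - a).val = k := by
      rw [add_sub_cancel_left, ZMod.val_cast_of_lt hk]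
    omega
  · rintro ⟨h1, h2⟩
    exact ⟨(x - a).val, h1, h2, by rw [ZMod.natCast_zmod_val]; ring⟩

theorem val_pos_of_ne {m : ℕ} [NeZero m] {a x : ZMod m} (h : x ≠ a) : 0 < (x - a).val := by
  rw [Nat.pos_iff_ne_zero]
  intro h0
  exact h (sub_eq_zero.1 ((ZMod.val_eq_zero _).1 h0))

theorem val_succ {m : ℕ} [NeZero m] {a x : ZMod m} (h : x + 1 ≠ a) :
    (x + 1 - a).val = (x - a).val + 1 := by
  have hlt := ZMod.val_lt (x - a)
  have e : x + 1 - a = (((x - a).val + 1 : ℕ) : ZMod m) := by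
    push_cast
    rw [ZMod.natCast_zmod_val]; ring
  have hne : (x - a).val + 1 ≠ m := by
    intro h0
    rw [h0, ZMod.natCast_self] at e
    exact h (sub_eq_zero.1 e)
  rw [e, ZMod.val_cast_of_lt (by omega)]

theorem val_inj_ne {m : ℕ} [NeZero m] {a b x : ZMod m} (h : x ≠ b) :
    (x - a).val ≠ (b - a).val := by
  intro h0
  exact h (sub_left_injective (ZMod.val_injective m h0))

theorem arc_succ {m : ℕ} [NeZero m] {a b x : ZMod m} (h1 : x ≠ a)
    (h3 : x + 1 ≠ a) (h4 : x + 1 ≠ b) :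
    inOpenArc a b x ↔ inOpenArc a b (x + 1) := by
  rw [arc_iff, arc_iff, val_succ h3]
  have := val_pos_of_ne h1
  have h := val_inj_ne (a := a) h4
  rw [val_succ h3] at h
  omega

theorem val_sub_flip {m : ℕ} [NeZero m] {a b x : ZMod m} (hab : a ≠ b) :
    (x - b).val = if (b - a).val ≤ (x - a).val then (x - a).val - (b - a).val
      else (x - a).val + m - (b - a).val := by
  have e : x - b = (x - a) - (b - a) := by ring
  have hx := ZMod.val_lt (x - a)
  have hb := ZMod.val_lt (b - a)
  split_ifs with h
  · rw [e, ZMod.val_sub h]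
  · have e2 : x - b = (((x - a).val + m - (b - a).val : ℕ) : ZMod m) := by
      rw [Nat.cast_sub (by omega)]
      push_cast
      simp
    rw [e2, ZMod.val_cast_of_lt (by omega)]

theorem arc_flip {m : ℕ} [NeZero m] {a b x : ZMod m} (hab : a ≠ b) (h1 : x ≠ a) (h2 : x ≠ b) :
    inOpenArc b a x ↔ ¬ inOpenArc a b x := by
  rw [arc_iff, arc_iff, val_sub_flip (x := x) hab, val_sub_flip (x := a) hab]
  have := val_pos_of_ne h1
  have := val_pos_of_ne hab.symm
  have := val_inj_ne (a := a) h2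
  have hx := ZMod.val_lt (x - a)
  have hb := ZMod.val_lt (b - a)
  simp only [sub_self, ZMod.val_zero]
  split_ifs <;> omega

theorem pair_cases {α : Type*} [DecidableEq α] {a b c d : α}
    (h : ({a, b} : Finset α) = {c, d}) : (a = c ∧ b = d) ∨ (a = d ∧ b = c) := by
  have : ({a, b} : Set α) = {c, d} := by
    have := congrArg (fun s : Finset α => (s : Set α)) h
    simpa using this
  exact Set.pair_eq_pair_iff.1 this

theorem linkedPair_iff {m : ℕ} [NeZero m] {a b c d : ZMod m} (hab : a ≠ b)
    (h1 : c ≠ a) (h2 : c ≠ b) (h3 : d ≠ a) (h4 : d ≠ b) :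
    linkedPair {a, b} {c, d} ↔ linked a b c d := by
  constructor
  · rintro ⟨a', b', c', d', hP, hQ, hl⟩
    have f1 := arc_flip hab h1 h2
    have f2 := arc_flip hab h3 h4
    rcases pair_cases hP with ⟨rfl, rfl⟩ | ⟨rfl, rfl⟩ <;>
    rcases pair_cases hQ with ⟨rfl, rfl⟩ | ⟨rfl, rfl⟩ <;>
    simp only [linked, Xor', Xor] at hl ⊢ <;> tauto
  · intro h
    exact ⟨a, b, c, d, rfl, rfl, h⟩

theorem not_linked_self {m : ℕ} [NeZero m] (p q : ZMod m) :
    ¬ linkedPair ({p, q} : Finset (ZMod m)) {p, q} := by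
  rintro ⟨a, b, c, d, hP, hQ, hl⟩
  have ha : ∀ a b : ZMod m, ¬ inOpenArc a b a := by intro a b; rw [arc_iff]; simp
  have hb : ∀ a b : ZMod m, ¬ inOpenArc a b b := by intro a b; rw [arc_iff]; simp
  rw [hP] at hQ
  have h1 := ha a b
  have h2 := hb a b
  rcases pair_cases hQ with ⟨rfl, rfl⟩ | ⟨rfl, rfl⟩ <;>
    simp only [linked, Xor', Xor] at hl <;> tauto

/-- Parity axiom 2, parallel configuration: the two chords of a second
Reidemeister move have the same Gaussian parity. -/
theorem second_move_same_parity_parallel (n : ℕ) (hn : 2 ≤ n)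
    (f : ZMod (2 * n) → ZMod (2 * n)) (hinv : Function.Involutive f)
    (hfpf : ∀ x, f x ≠ x) (p q : ZMod (2 * n))
    (hdist : ({p, p + 1, q, q + 1} : Finset (ZMod (2 * n))).card = 4)
    (hp : f p = q) (hp1 : f (p + 1) = q + 1) :
    (∀ D ∈ chords f, D ≠ ({p, q} : Finset (ZMod (2 * n))) →
      D ≠ ({p + 1, q + 1} : Finset (ZMod (2 * n))) →
      (linkedPair D ({p, q} : Finset (ZMod (2 * n))) ↔
        linkedPair D ({p + 1, q + 1} : Finset (ZMod (2 * n))))) ∧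
    (Even (Set.ncard
        {D ∈ chords f | linkedPair D ({p, q} : Finset (ZMod (2 * n)))}) ↔
      Even (Set.ncard
        {D ∈ chords f | linkedPair D ({p + 1, q + 1} : Finset (ZMod (2 * n)))})) := by
  haveI : NeZero (2 * n) := ⟨by omega⟩
  have n1 : p ≠ p + 1 := by
    intro h; rw [← h] at hdist
    have := Finset.card_le_three (a := p) (b := q) (c := q + 1)
    simp only [Finset.insert_idem] at hdist
    omega
  have one_ne : (1 : ZMod (2 * n)) ≠ 0 := by
    intro h; apply n1; rw [h, add_zero]
  have n2 : q ≠ p := by rw [← hp]; exact hfpf p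
  have n3 : q ≠ p + 1 := by
    intro h
    have e : ({p, p + 1, q, q + 1} : Finset (ZMod (2 * n))) = {p, p + 1, q + 1} := by
      rw [h]; simp
    rw [e] at hdist
    have := Finset.card_le_three (a := p) (b := p + 1) (c := q + 1)
    omega
  have n4 : q + 1 ≠ p := by
    intro h
    have e : ({p, p + 1, q, q + 1} : Finset (ZMod (2 * n))) = {p + 1, q, p} := by
      rw [h]; ext x; simp only [Finset.mem_insert, Finset.mem_singleton]; tauto
    rw [e] at hdist
    have := Finset.card_le_three (a := p + 1) (b := q) (c := p)
    omega
  have n5 : q + 1 ≠ p + 1 := fun h => n2 (add_right_cancel h)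
  have n6 : q + 1 ≠ q := by simpa using one_ne
  have hq : f q = p := by rw [← hp, hinv]
  have hq1 : f (q + 1) = p + 1 := by rw [← hp1, hinv]
  have key : ∀ D ∈ chords f, D ≠ ({p, q} : Finset (ZMod (2 * n))) →
      D ≠ ({p + 1, q + 1} : Finset (ZMod (2 * n))) →
      (linkedPair D ({p, q} : Finset (ZMod (2 * n))) ↔
        linkedPair D ({p + 1, q + 1} : Finset (ZMod (2 * n)))) := by
    rintro D ⟨a, rfl⟩ h1 h2
    have a1 : p ≠ a := by rintro rfl; exact h1 (by rw [hp])
    have a2 : q ≠ a := by rintro rfl; exact h1 (by rw [hq, Finset.pair_comm])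
    have a3 : p + 1 ≠ a := by rintro rfl; exact h2 (by rw [hp1])
    have a4 : q + 1 ≠ a := by rintro rfl; exact h2 (by rw [hq1, Finset.pair_comm])
    have b1 : p ≠ f a := fun h => a2 (by rw [← hp, h, hinv])
    have b2 : q ≠ f a := fun h => a1 (by rw [← hq, h, hinv])
    have b3 : p + 1 ≠ f a := fun h => a4 (by rw [← hp1, h, hinv])
    have b4 : q + 1 ≠ f a := fun h => a3 (by rw [← hq1, h, hinv])
    rw [linkedPair_iff (hfpf a).symm a1 b1 a2 b2, linkedPair_iff (hfpf a).symm a3 b3 a4 b4]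
    unfold linked
    rw [arc_succ a1 a3 b3, arc_succ a2 a4 b4]
  refine ⟨key, ?_⟩
  have l21 : linkedPair ({p + 1, q + 1} : Finset (ZMod (2 * n))) {p, q} := by
    refine ⟨p + 1, q + 1, p, q, rfl, rfl, Or.inr ⟨?_, ?_⟩⟩
    · rw [arc_iff]
      have := val_succ (x := q) (a := p + 1) n5
      have := val_pos_of_ne n3
      omega
    · rw [arc_iff, val_sub_flip (x := p) (a := p) n1]
      have hv := val_sub_flip (x := q + 1) (a := p) n1
      have h1 := val_succ (x := p) (a := p) n1.symm
      simp only [sub_self, ZMod.val_zero] at h1 ⊢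
      have := ZMod.val_lt (q + 1 - p)
      rw [h1] at hv ⊢
      split_ifs at hv ⊢ <;> omega
  have l12 : linkedPair ({p, q} : Finset (ZMod (2 * n))) {p + 1, q + 1} := by
    refine ⟨p, q, p + 1, q + 1, rfl, rfl, Or.inl ⟨?_, ?_⟩⟩
    · rw [arc_iff]
      have h1 := val_succ (x := p) (a := p) n1.symm
      simp only [sub_self, ZMod.val_zero] at h1
      have := val_inj_ne (a := p) n3
      have := val_pos_of_ne n2
      omega
    · rw [arc_iff, val_succ n4]
      omega
  have hne : ({p, q} : Finset (ZMod (2 * n))) ≠ {p + 1, q + 1} := by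
    intro h
    rcases pair_cases h with ⟨h, _⟩ | ⟨h, _⟩
    · exact n1 h
    · exact n4 h.symm
  set c₁ : Finset (ZMod (2 * n)) := {p, q} with hc1
  set c₂ : Finset (ZMod (2 * n)) := {p + 1, q + 1} with hc2
  have m1 : c₁ ∈ chords f := ⟨p, by rw [hp]⟩
  have m2 : c₂ ∈ chords f := ⟨p + 1, by rw [hp1]⟩
  have s1 : ¬ linkedPair c₁ c₁ := not_linked_self p q
  have s2 : ¬ linkedPair c₂ c₂ := not_linked_self (p + 1) (q + 1)
  let T : Set (Finset (ZMod (2 * n))) := {D | D ∈ chords f ∧ D ≠ c₁ ∧ D ≠ c₂ ∧ linkedPair D c₁}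
  have e1 : {D ∈ chords f | linkedPair D c₁} = insert c₂ T := by
    ext D
    simp only [Set.mem_setOf_eq, Set.mem_insert_iff, T]
    constructor
    · rintro ⟨h, hl⟩
      by_cases hD : D = c₂
      · exact Or.inl hD
      · exact Or.inr ⟨h, fun h0 => s1 (h0 ▸ hl), hD, hl⟩
    · rintro (h | h)
      · rw [h]; exact ⟨m2, l21⟩
      · exact ⟨h.1, h.2.2.2⟩
  have e2 : {D ∈ chords f | linkedPair D c₂} = insert c₁ T := by
    ext D
    simp only [Set.mem_setOf_eq, Set.mem_insert_iff, T]
    constructor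
    · rintro ⟨h, hl⟩
      by_cases hD : D = c₁
      · exact Or.inl hD
      · have hD2 : D ≠ c₂ := fun h0 => s2 (h0 ▸ hl)
        exact Or.inr ⟨h, hD, hD2, (key D h hD hD2).2 hl⟩
    · rintro (h | h)
      · rw [h]; exact ⟨m1, l12⟩
      · exact ⟨h.1, (key D h.1 h.2.1 h.2.2.1).1 h.2.2.2⟩
  have t1 : c₁ ∉ T := fun h => h.2.1 rfl
  have t2 : c₂ ∉ T := fun h => h.2.2.1 rfl
  rw [e1, e2, Set.ncard_insert_of_notMem t2 (Set.toFinite T),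
    Set.ncard_insert_of_notMem t1 (Set.toFinite T)]
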